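/- Fix k ≥ 2 and, for 2 ≤ l ≤ k, define in the group algebra ℚ[S_k] the element B⁻_l := (1/l!) • (1 − (l−1) • t_{l−1,l}) * (1 − (l−2) • t_{l−2,l−1}) * ⋯ * (1 − 1 • t_{1,2}). Then the full antisymmetrizer satisfies A_k = B⁻_2 * B⁻_3 * ⋯ * B⁻_k. -/

import Mathlib

/-- The full antisymmetrizer `A_k = (1/k!) Σ_σ sgn(σ) • σ` in `ℚ[S_k]`. -/
noncomputable def antisymmetrizer (k : ℕ) : MonoidAlgebra ℚ (Equiv.Perm (Fin k)) :=
  ((k.factorial : ℚ))⁻¹ •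
    ∑ σ : Equiv.Perm (Fin k),
      ((Equiv.Perm.sign σ : ℤ) : ℚ) • MonoidAlgebra.of ℚ (Equiv.Perm (Fin k)) σ

/-- The transposition `t_{i,j}` of the `i`-th and `j`-th points (1-based labels),
as an element of the group algebra `ℚ[S_k]`.  (For labels out of range it is
defined to be the identity; all uses below are in range.) -/
noncomputable def transposition (k i j : ℕ) : MonoidAlgebra ℚ (Equiv.Perm (Fin k)) :=
  MonoidAlgebra.of ℚ (Equiv.Perm (Fin k))
    (if h : 1 ≤ i ∧ i ≤ k ∧ 1 ≤ j ∧ j ≤ k then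
      Equiv.swap ⟨i - 1, by omega⟩ ⟨j - 1, by omega⟩ else 1)

/-- `B⁻_l = (1/l!) • (1 − (l−1) • t_{l−1,l}) * (1 − (l−2) • t_{l−2,l−1}) * ⋯ * (1 − 1 • t_{1,2})`
in `ℚ[S_k]`: the `m`-th factor (for `m = 0, …, l-2`) is `1 − (l−1−m) • t_{l−1−m, l−m}`. -/
noncomputable def Bminus (k l : ℕ) : MonoidAlgebra ℚ (Equiv.Perm (Fin k)) :=
  ((l.factorial : ℚ))⁻¹ •
    ((List.range (l - 1)).map (fun m =>
      (1 : MonoidAlgebra ℚ (Equiv.Perm (Fin k))) -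
        ((l - 1 - m : ℕ) : ℚ) • transposition k (l - 1 - m) (l - m))).prod

section Fusion

variable {R : Type*} [Ring R] [Algebra ℚ R]

/-- The product `(1 - n • s (n-1)) * ⋯ * (1 - 2 • s 1) * (1 - 1 • s 0)`. -/
def descProd (s : ℕ → R) : ℕ → R
  | 0 => 1
  | n + 1 => (1 - ((n + 1 : ℕ) : ℚ) • s n) * descProd s n

/-- The product of the normalized elements `((m + 1)!)⁻¹ • descProd s m` for `1 ≤ m ≤ n`. -/
def fusionProd (s : ℕ → R) : ℕ → R
  | 0 => 1
  | n + 1 => fusionProd s n * (((n + 2).factorial : ℚ)⁻¹ • descProd s (n + 1))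

theorem commute_descProd {s : ℕ → R} {x : R} {n : ℕ} (h : ∀ i < n, Commute x (s i)) :
    Commute x (descProd s n) := by
  induction n with
  | zero => exact Commute.one_right x
  | succ n ih =>
    exact ((Commute.one_right x).sub_right ((h n n.lt_succ_self).smul_right _)).mul_right
      (ih fun i hi => h i (by omega))

theorem commute_fusionProd {s : ℕ → R} {x : R} {n : ℕ} (h : ∀ i < n, Commute x (s i)) :
    Commute x (fusionProd s n) := by
  induction n with
  | zero => exact Commute.one_right x
  | succ n ih =>
    exact (ih fun i hi => h i (by omega)).mul_right ((commute_descProd h).smul_right _)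

theorem fusionProd_mul_descProd (s : ℕ → R) (n : ℕ) :
    fusionProd s n * descProd s (n + 1) = ((n + 2).factorial : ℚ) • fusionProd s (n + 1) := by
  have h : ((n + 2).factorial : ℚ) ≠ 0 := by positivity
  rw [fusionProd, mul_smul_comm, smul_smul, mul_inv_cancel₀ h, one_smul]

/-- One step of the fusion procedure: `g`, `f` and `f'` play the roles of the antisymmetrizers of
three consecutive symmetric groups, and `t`, `s` those of two adjacent simple transpositions. -/
theorem mul_eq_neg_of_braid {s t g f f' : R} {c : ℚ} (hc : c + 1 ≠ 0) (hs : s * s = 1)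
    (hst : s * t * s = t * s * t) (hsg : Commute s g) (hgf : g * f = f) (htf : t * f = -f)
    (hff : f * f = f) (hf : c • f = g * (1 - (c - 1) • t) * g)
    (hf' : (c + 1) • f' = f * (1 - c • s) * f) : s * f' = -f' := by
  have hcfsf : c • (f * s * f) = s * f - (c - 1) • (g * t * s * f) := by
    calc c • (f * s * f) = (c • f) * (s * f) := by rw [smul_mul_assoc, mul_assoc]
      _ = g * (1 - (c - 1) • t) * ((g * s) * f) := by rw [hf]; simp only [mul_assoc]
      _ = g * (1 - (c - 1) • t) * (s * f) := by rw [← hsg.eq, mul_assoc s, hgf]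
      _ = (g * s) * f - (c - 1) • (g * t * s * f) := by
        simp only [mul_sub, sub_mul, mul_one, mul_smul_comm, smul_mul_assoc, mul_assoc]
      _ = _ := by rw [← hsg.eq, mul_assoc s, hgf]
  have hcsfsf : s * (c • (f * s * f)) = f + (c - 1) • (g * t * s * f) := by
    have h : s * (g * t * s * f) = -(g * t * s * f) := by
      calc s * (g * t * s * f) = (s * g) * t * s * f := by simp only [mul_assoc]
        _ = g * (s * t * s) * f := by rw [hsg.eq]; simp only [mul_assoc]
        _ = g * t * s * (t * f) := by rw [hst]; simp only [mul_assoc]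
        _ = _ := by rw [htf, mul_neg]
    rw [hcfsf, mul_sub, mul_smul_comm, h, ← mul_assoc, hs, one_mul, smul_neg, sub_neg_eq_add]
  have hexp : (c + 1) • f' = f - c • (f * s * f) := by
    rw [hf', mul_sub, sub_mul, mul_one, hff, mul_smul_comm, smul_mul_assoc]
  refine smul_right_injective R hc ?_
  simp only [smul_neg]
  rw [← mul_smul_comm, hexp, mul_sub, hcsfsf, hcfsf]
  abel

theorem succ_smul_fusionProd_succ {s : ℕ → R} {n : ℕ}
    (hright : fusionProd s (n + 1) * fusionProd s n = fusionProd s (n + 1))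
    (hcomm : ∀ i < n, Commute (s (n + 1)) (s i)) :
    (((n + 2 : ℕ) : ℚ) + 1) • fusionProd s (n + 2) =
      fusionProd s (n + 1) * (1 - ((n + 2 : ℕ) : ℚ) • s (n + 1)) * fusionProd s (n + 1) := by
  have hfac : ((n + 2).factorial : ℚ) ≠ 0 := by positivity
  have hg : Commute (fusionProd s n) (1 - ((n + 2 : ℕ) : ℚ) • s (n + 1)) :=
    (Commute.one_right _).sub_right ((commute_fusionProd hcomm).symm.smul_right _)
  refine smul_right_injective R hfac ?_
  calc ((n + 2).factorial : ℚ) • (((n + 2 : ℕ) : ℚ) + 1) • fusionProd s (n + 2)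
      = fusionProd s (n + 1) * descProd s (n + 2) := by
        rw [fusionProd_mul_descProd, smul_smul, Nat.factorial_succ (n + 2)]
        push_cast
        rw [mul_comm]
    _ = fusionProd s (n + 1) * (fusionProd s n * (1 - ((n + 2 : ℕ) : ℚ) • s (n + 1))) *
          descProd s (n + 1) := by
        rw [← mul_assoc (fusionProd s (n + 1)) (fusionProd s n), hright, mul_assoc]
        rfl
    _ = fusionProd s (n + 1) * (1 - ((n + 2 : ℕ) : ℚ) • s (n + 1)) *
          (fusionProd s n * descProd s (n + 1)) := by
        rw [hg.eq]
        simp only [mul_assoc]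
    _ = _ := by rw [fusionProd_mul_descProd, mul_smul_comm]

/-- For elements satisfying the Coxeter relations of type `A`, the product `fusionProd s n` is
idempotent and is negated by left multiplication with each `s i`, `i < n`. -/
theorem fusionProd_antisymmetric {s : ℕ → R} {N : ℕ} (hsq : ∀ i < N, s i * s i = 1)
    (hbraid : ∀ i, i + 1 < N → s (i + 1) * s i * s (i + 1) = s i * s (i + 1) * s i)
    (hcomm : ∀ i j, i + 1 < j → j < N → Commute (s j) (s i)) {n : ℕ} (hn : n ≤ N) :
    (∀ i < n, s i * fusionProd s n = -fusionProd s n) ∧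
      fusionProd s n * fusionProd s n = fusionProd s n := by
  suffices H : ∀ n, n + 1 ≤ N →
      (fusionProd s n * fusionProd s n = fusionProd s n) ∧
      (∀ i < n + 1, s i * fusionProd s (n + 1) = -fusionProd s (n + 1)) ∧
      (fusionProd s (n + 1) * fusionProd s (n + 1) = fusionProd s (n + 1)) ∧
      (((n + 1 : ℕ) : ℚ) + 1) • fusionProd s (n + 1) =
        fusionProd s n * (1 - ((n + 1 : ℕ) : ℚ) • s n) * fusionProd s n by
    cases n with
    | zero => simp [fusionProd]
    | succ n => exact ⟨(H n hn).2.1, (H n hn).2.2.1⟩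
  have idem : ∀ n, fusionProd s n * fusionProd s n = fusionProd s n →
      s n * fusionProd s (n + 1) = -fusionProd s (n + 1) →
      (((n + 1 : ℕ) : ℚ) + 1) • fusionProd s (n + 1) =
        fusionProd s n * (1 - ((n + 1 : ℕ) : ℚ) • s n) * fusionProd s n →
      fusionProd s (n + 1) * fusionProd s (n + 1) = fusionProd s (n + 1) := by
    intro n hff hneg hsand
    have hc : ((n + 1 : ℕ) : ℚ) + 1 ≠ 0 := by positivity
    have hleft : fusionProd s n * fusionProd s (n + 1) = fusionProd s (n + 1) := by
      rw [fusionProd, ← mul_assoc, hff]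
    refine smul_right_injective R hc ?_
    simp only
    rw [← smul_mul_assoc, hsand, mul_assoc, hleft, mul_assoc, sub_mul, one_mul, smul_mul_assoc,
      hneg, smul_neg, sub_neg_eq_add, mul_add, mul_smul_comm, hleft,
      ← hsand, add_smul, one_smul, add_comm]
  intro n
  induction n with
  | zero =>
    intro hN
    have hsand : (((0 + 1 : ℕ) : ℚ) + 1) • fusionProd s (0 + 1) =
        fusionProd s 0 * (1 - ((0 + 1 : ℕ) : ℚ) • s 0) * fusionProd s 0 := by
      simp only [fusionProd, descProd, smul_smul, one_mul, mul_one]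
      norm_num [Nat.factorial]
    have hneg : s 0 * fusionProd s (0 + 1) = -fusionProd s (0 + 1) := by
      simp only [fusionProd, descProd, one_mul, mul_one, mul_smul_comm, mul_sub, hsq 0 hN,
        ← smul_neg]
      simp
    have h0 : fusionProd s 0 * fusionProd s 0 = fusionProd s 0 := one_mul 1
    refine ⟨h0, fun i hi => ?_, idem 0 h0 hneg hsand, hsand⟩
    obtain rfl : i = 0 := by omega
    exact hneg
  | succ n ih =>
    intro hN
    obtain ⟨hgg, hneg, hff, hsand⟩ := ih (by omega)
    have hgf : fusionProd s n * fusionProd s (n + 1) = fusionProd s (n + 1) := by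
      rw [fusionProd, ← mul_assoc, hgg]
    have hfg : fusionProd s (n + 1) * fusionProd s n = fusionProd s (n + 1) := by
      have hc : ((n + 1 : ℕ) : ℚ) + 1 ≠ 0 := by positivity
      refine smul_right_injective R hc ?_
      simp only
      rw [← smul_mul_assoc, hsand, mul_assoc, hgg]
    have hcomm' : ∀ i < n, Commute (s (n + 1)) (s i) := fun i hi =>
      hcomm i (n + 1) (by omega) (by omega)
    have hsand' := succ_smul_fusionProd_succ hfg hcomm'
    have hneg' : s (n + 1) * fusionProd s (n + 2) = -fusionProd s (n + 2) := by
      refine mul_eq_neg_of_braid (c := ((n + 2 : ℕ) : ℚ)) (by positivity) (hsq _ hN)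
        (hbraid n hN) (commute_fusionProd hcomm') hgf (hneg n n.lt_succ_self) hff ?_ hsand'
      convert hsand using 4 <;> push_cast <;> ring_nf
    refine ⟨hff, fun i hi => ?_, idem (n + 1) hff hneg' hsand', hsand'⟩
    rcases Nat.lt_succ_iff_lt_or_eq.mp hi with hi | rfl
    · rw [fusionProd, ← mul_assoc, hneg i hi, neg_mul]
    · exact hneg'

theorem map_fusionProd {s : ℕ → R} {n : ℕ} (φ : R →ₐ[ℚ] ℚ) (h : ∀ i < n, φ (s i) = -1) :
    φ (fusionProd s n) = 1 := by
  have hD : ∀ m ≤ n, φ (descProd s m) = ((m + 1).factorial : ℚ) := by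
    intro m
    induction m with
    | zero => simp [descProd]
    | succ m ih =>
      intro hm
      rw [descProd, map_mul, map_sub, map_one, map_smul, h m hm, ih (by omega),
        Nat.factorial_succ (m + 1)]
      push_cast
      rw [smul_eq_mul]
      ring
  have hF : ∀ m ≤ n, φ (fusionProd s m) = 1 := by
    intro m
    induction m with
    | zero => simp [fusionProd]
    | succ m ih =>
      intro hm
      rw [fusionProd, map_mul, map_smul, hD _ hm, ih (by omega), one_mul, smul_eq_mul]
      exact inv_mul_cancel₀ (by positivity)
  exact hF n le_rfl

end Fusion

section Perm

open Equiv MonoidAlgebra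

variable {k : ℕ}

/-- The sign representation, as an algebra homomorphism `ℚ[S_k] → ℚ`. -/
noncomputable def signAlgHom (k : ℕ) : MonoidAlgebra ℚ (Perm (Fin k)) →ₐ[ℚ] ℚ :=
  MonoidAlgebra.lift ℚ ℚ (Perm (Fin k))
    ((Int.castRingHom ℚ : ℤ →* ℚ).comp ((Units.coeHom ℤ).comp Perm.sign))

theorem signAlgHom_of (σ : Perm (Fin k)) :
    signAlgHom k (of ℚ _ σ) = ((Perm.sign σ : ℤ) : ℚ) := by
  rw [signAlgHom, lift_of]
  rfl

theorem sign_mul_sign_rat (σ : Perm (Fin k)) :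
    ((Perm.sign σ : ℤ) : ℚ) * ((Perm.sign σ : ℤ) : ℚ) = 1 := by
  rw [← Int.cast_mul, ← Units.val_mul, Int.units_mul_self, Units.val_one, Int.cast_one]

theorem antisymmetrizer_mul_of (τ : Perm (Fin k)) :
    antisymmetrizer k * of ℚ _ τ = ((Perm.sign τ : ℤ) : ℚ) • antisymmetrizer k := by
  rw [antisymmetrizer, smul_mul_assoc, smul_comm ((Perm.sign τ : ℤ) : ℚ)]
  congr 1
  rw [Finset.sum_mul, Finset.smul_sum]
  refine Fintype.sum_equiv (Equiv.mulRight τ) _ _ fun σ => ?_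
  rw [Equiv.coe_mulRight, smul_mul_assoc, ← map_mul, smul_smul, map_mul Perm.sign, Units.val_mul,
    Int.cast_mul, mul_left_comm, sign_mul_sign_rat,
    mul_one]

theorem antisymmetrizer_mul (x : MonoidAlgebra ℚ (Perm (Fin k))) :
    antisymmetrizer k * x = signAlgHom k x • antisymmetrizer k := by
  induction x using MonoidAlgebra.induction_on with
  | of σ => rw [antisymmetrizer_mul_of, signAlgHom_of]
  | add x y hx hy => rw [mul_add, hx, hy, map_add, add_smul]
  | smul r x hx => rw [mul_smul_comm, hx, map_smul, smul_assoc]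

theorem antisymmetrizer_mul_eq_self {x : MonoidAlgebra ℚ (Perm (Fin k))}
    (hx : ∀ σ, of ℚ _ σ * x = ((Perm.sign σ : ℤ) : ℚ) • x) : antisymmetrizer k * x = x := by
  simp only [antisymmetrizer, smul_mul_assoc, Finset.sum_mul, hx, smul_smul, sign_mul_sign_rat,
    one_smul, Finset.sum_const, Finset.card_univ, Fintype.card_perm, Fintype.card_fin]
  rw [← Nat.cast_smul_eq_nsmul ℚ, smul_smul, inv_mul_cancel₀ (by positivity), one_smul]

theorem of_mul_eq_sign_smul {n : ℕ} {x : MonoidAlgebra ℚ (Perm (Fin (n + 1)))}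
    (hx : ∀ i : Fin n, of ℚ _ (swap i.castSucc i.succ) * x = -x) (σ : Perm (Fin (n + 1))) :
    of ℚ _ σ * x = ((Perm.sign σ : ℤ) : ℚ) • x := by
  have hσ : σ ∈ Submonoid.closure (Set.range fun i : Fin n => swap i.castSucc i.succ) := by
    rw [Perm.mclosure_swap_castSucc_succ]
    trivial
  induction hσ using Submonoid.closure_induction with
  | mem σ h =>
    obtain ⟨i, rfl⟩ := h
    rw [hx i, Perm.sign_swap Fin.castSucc_lt_succ.ne]
    simp
  | one => rw [map_one, one_mul, map_one, Units.val_one, Int.cast_one, one_smul]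
  | mul σ τ _ _ hσ hτ =>
    rw [map_mul, mul_assoc, hτ, mul_smul_comm, hσ, smul_smul, map_mul, Units.val_mul,
      Int.cast_mul, mul_comm]

/-- The simple transposition of the points `i` and `i + 1` (0-based), in the group algebra. -/
noncomputable def simpleTransposition (k i : ℕ) : MonoidAlgebra ℚ (Perm (Fin k)) :=
  transposition k (i + 1) (i + 2)

theorem simpleTransposition_eq {i : ℕ} (h : i + 1 < k) :
    simpleTransposition k i = of ℚ _ (swap ⟨i, by omega⟩ ⟨i + 1, h⟩) := by
  rw [simpleTransposition, transposition, dif_pos (by omega)]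
  rfl

theorem simpleTransposition_mul_self {i : ℕ} (h : i + 1 < k) :
    simpleTransposition k i * simpleTransposition k i = 1 := by
  rw [simpleTransposition_eq h, ← map_mul, swap_mul_self, map_one]

theorem swap_mul_swap_mul_swap_comm {α : Type*} [DecidableEq α] {x y z : α} (hxy : x ≠ y)
    (hxz : x ≠ z) (hyz : y ≠ z) :
    swap y z * swap x y * swap y z = swap x y * swap y z * swap x y := by
  rw [swap_mul_swap_mul_swap hxy hxz, swap_comm x y, swap_comm y z,
    swap_mul_swap_mul_swap hyz.symm hxz.symm, swap_comm]

theorem simpleTransposition_braid {i : ℕ} (h : i + 1 + 1 < k) :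
    simpleTransposition k (i + 1) * simpleTransposition k i * simpleTransposition k (i + 1) =
      simpleTransposition k i * simpleTransposition k (i + 1) * simpleTransposition k i := by
  rw [simpleTransposition_eq h, simpleTransposition_eq (show i + 1 < k by omega)]
  simp only [← map_mul]
  congr 1
  exact swap_mul_swap_mul_swap_comm (by simp) (by simp [add_assoc]) (by simp)

theorem simpleTransposition_commute {i j : ℕ} (hij : i + 1 < j) (h : j + 1 < k) :
    Commute (simpleTransposition k j) (simpleTransposition k i) := by
  rw [simpleTransposition_eq h, simpleTransposition_eq (show i + 1 < k by omega)]
  refine Commute.map ?_ (of ℚ (Perm (Fin k)))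
  refine (Perm.Disjoint.commute ?_)
  rw [Perm.disjoint_iff_disjoint_support, Perm.support_swap (by simp), Perm.support_swap (by simp)]
  simp
  omega

theorem Bminus_eq (k n : ℕ) :
    Bminus k (n + 1) =
      ((n + 1).factorial : ℚ)⁻¹ • descProd (simpleTransposition k) n := by
  rw [Bminus, Nat.add_sub_cancel]
  congr 1
  induction n with
  | zero => rfl
  | succ n ih =>
    rw [List.range_succ_eq_map, List.map_cons, List.prod_cons, List.map_map, descProd, ← ih]
    congr 2
    refine List.map_congr_left fun m hm => ?_
    simp only [Function.comp_apply, Nat.succ_eq_add_one, Nat.add_sub_add_right]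

theorem prod_Bminus_eq (k n : ℕ) :
    ((List.range n).map fun i => Bminus k (i + 2)).prod =
      fusionProd (simpleTransposition k) n := by
  induction n with
  | zero => rfl
  | succ n ih =>
    rw [List.range_succ, List.map_append, List.prod_append, ih, List.map_singleton,
      List.prod_singleton, Bminus_eq, fusionProd]

end Perm

/-- The full antisymmetrizer factors as `A_k = B⁻_2 * B⁻_3 * ⋯ * B⁻_k`. -/
theorem antisymmetrizer_eq_prod_Bminus (k : ℕ) (hk : 2 ≤ k) :
    antisymmetrizer k = ((List.range (k - 1)).map (fun i => Bminus k (i + 2))).prod := by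
  obtain ⟨n, rfl⟩ : ∃ n, k = n + 1 := ⟨k - 1, by omega⟩
  rw [Nat.add_sub_cancel, prod_Bminus_eq]
  obtain ⟨hneg, -⟩ := fusionProd_antisymmetric (s := simpleTransposition (n + 1)) (N := n)
    (fun i hi => simpleTransposition_mul_self (by omega))
    (fun i hi => simpleTransposition_braid (by omega))
    (fun i j hij hj => simpleTransposition_commute hij (by omega)) le_rfl
  have hsign : signAlgHom (n + 1) (fusionProd (simpleTransposition (n + 1)) n) = 1 := by
    refine map_fusionProd _ fun i hi => ?_
    rw [simpleTransposition_eq (by omega), signAlgHom_of, Equiv.Perm.sign_swap (by simp)]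
    simp
  have hswap (i : Fin n) :
      MonoidAlgebra.of ℚ (Equiv.Perm (Fin (n + 1))) (Equiv.swap i.castSucc i.succ) =
        simpleTransposition (n + 1) i :=
    (simpleTransposition_eq (Nat.succ_lt_succ i.isLt)).symm
  have hself := antisymmetrizer_mul_eq_self
    (of_mul_eq_sign_smul fun i => (hswap i).symm ▸ hneg i i.isLt)
  rw [← hself, antisymmetrizer_mul, hsign, one_smul]
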